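/- arXiv:1912.04653 — 2 statements merged into one kernel-verified Lean document; each statement's English description precedes it below -/
import Mathlib

section
/- Let p be an odd prime, let F_q be a finite field of characteristic p, and let ν_p = max over γ ∈ F_p \ {1} of the cardinality of {1 ≤ i ≤ p−2 : γ^{i+1} = i(1−γ) + 1 in F_p}. If f is a permutation polynomial of F_q with Carlitz rank Crk(f) = 2, then ω(f) ≥ q − q/p − 1 − ν_p. -/
open Polynomial

noncomputable def carlitzChain {F : Type*} [Field F] (q : ℕ) (a : ℕ → F) : ℕ → F[X]
  | 0 => C (a 0) * X + C (a 1)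
  | n + 1 => carlitzChain q a n ^ (q - 2) + C (a (n + 2))

/-- `f` is congruent mod `X^q - X` to a Carlitz chain of length `n`. -/
def IsCarlitzRep {F : Type*} [Field F] (q : ℕ) (f : F[X]) (n : ℕ) : Prop :=
  ∃ a : ℕ → F, a 0 ≠ 0 ∧ (∀ i, 2 ≤ i → i ≤ n → a i ≠ 0) ∧
    (X ^ q - X : F[X]) ∣ f - carlitzChain q a n

/-- The Carlitz rank of a permutation polynomial. -/
noncomputable def carlitzRank {F : Type*} [Field F] (q : ℕ) (f : F[X]) : ℕ :=
  sInf {n | IsCarlitzRep q f n}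

/-- The weight: number of nonzero coefficients of the reduction of `f` mod `X^q - X`. -/
noncomputable def polyWeight {F : Type*} [Field F] (q : ℕ) (f : F[X]) : ℕ :=
  (f %ₘ (X ^ q - X)).support.card

/-- `ν_p` from the paper. -/
noncomputable def nuP (p : ℕ) [Fact p.Prime] : ℕ :=
  Finset.sup (Finset.univ.erase (1 : ZMod p)) fun γ =>
    ((Finset.Icc 1 (p - 2)).filter
      (fun i : ℕ => γ ^ (i + 1) = (i : ZMod p) * (1 - γ) + 1)).card

section Counting

variable {F : Type*} [Field F] {p : ℕ} [CharP F p]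

/-- Solutions `k` in a window of length `p * ord β * c` are determined by `β ^ (k + 1)` and the
subwindow of length `p * ord β` containing `k`. -/
theorem card_solutions_le [Fact p.Prime] {β : F} (hβ1 : β ≠ 1) (hd : (orderOf β).Coprime p)
    (A : Finset ℕ) (S : Finset F) (a c : ℕ) (hA : ∀ k ∈ A, β ^ (k + 1) = k * (1 - β) + 1)
    (hS : ∀ k ∈ A, β ^ (k + 1) ∈ S) (ha : ∀ k ∈ A, a ≤ k)
    (hc : ∀ k ∈ A, k < a + p * orderOf β * c) :
    A.card ≤ S.card * c := by
  rw [← Finset.card_range c, ← Finset.card_product]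
  refine Finset.card_le_card_of_injOn
    (fun k => (β ^ (k + 1), (k - a) / (p * orderOf β))) ?_ ?_
  · intro k hk
    simp only [Finset.coe_product, Set.mem_prod, Finset.mem_coe, Finset.mem_range]
    refine ⟨hS k hk, Nat.div_lt_of_lt_mul ?_⟩
    have := ha k hk
    have := hc k hk
    omega
  · intro k hk l hl hkl
    obtain ⟨hpow, hdiv⟩ := Prod.mk.inj hkl
    have hk' := ha k hk
    have hl' := ha l hl
    have hβ0 : β ≠ 0 := by
      rintro rfl
      have h := hd
      rw [show orderOf (0 : F) = 0 from orderOf_eq_zero_iff'.2 fun n hn => by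
        simp [hn.ne']] at h
      exact (Fact.out : p.Prime).one_lt.ne' (by simpa using h)
    have hmodp : k ≡ l [MOD p] := by
      have h : ((k : F) - l) * (1 - β) = 0 := by
        linear_combination hA l hl - hA k hk + hpow
      refine (CharP.natCast_eq_natCast F p).1 ?_
      exact sub_eq_zero.1 ((mul_eq_zero.1 h).resolve_right (sub_ne_zero.2 hβ1.symm))
    have hmodd : k ≡ l [MOD orderOf β] := by
      have h : β ^ k = β ^ l := by
        have := hpow
        rw [pow_succ, pow_succ] at this
        exact mul_right_cancel₀ hβ0 this
      lift β to Fˣ using hβ0.isUnit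
      rw [orderOf_units]
      exact pow_eq_pow_iff_modEq.1 (by exact_mod_cast h)
    have hmod : (k - a) ≡ (l - a) [MOD p * orderOf β] := by
      have h := (Nat.modEq_and_modEq_iff_modEq_mul hd.symm).1 ⟨hmodp, hmodd⟩
      refine Nat.ModEq.add_right_cancel' a ?_
      rwa [Nat.sub_add_cancel hk', Nat.sub_add_cancel hl']
    have h : k - a = l - a := by
      rw [← Nat.div_add_mod (k - a) (p * orderOf β), hdiv, hmod, Nat.div_add_mod]
    omega

variable [Fintype F]

theorem coprime_orderOf_char {β : F} (hβ0 : β ≠ 0) : (orderOf β).Coprime p := by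
  obtain ⟨n, hp, hq⟩ := FiniteField.card F p
  have h1 : orderOf β ∣ Fintype.card F - 1 :=
    orderOf_dvd_of_pow_eq_one (FiniteField.pow_card_sub_one_eq_one β hβ0)
  refine ((Nat.Prime.coprime_iff_not_dvd hp).2 fun h => ?_).symm
  have h2 : p ∣ Fintype.card F := hq ▸ dvd_pow_self p n.ne_zero
  have h3 := (Nat.dvd_sub h2 (h.trans h1))
  have := Fintype.card_pos (α := F)
  rw [show Fintype.card F - (Fintype.card F - 1) = 1 by omega] at h3
  exact hp.one_lt.ne' (Nat.dvd_one.1 h3)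

variable [DecidableEq F]

theorem card_filter_pow_orderOf_eq_one_le {β : F} (hβ0 : β ≠ 0) :
    (Finset.univ.filter fun x : F => x ^ orderOf β = 1).card ≤ orderOf β := by
  have hpos : 0 < orderOf β := by
    lift β to Fˣ using hβ0.isUnit
    rw [orderOf_units]
    exact orderOf_pos β
  calc _ ≤ (nthRootsFinset (orderOf β) (1 : F)).card :=
        Finset.card_le_card fun x hx => by
          rw [mem_nthRootsFinset hpos]
          exact (Finset.mem_filter.1 hx).2
    _ ≤ _ := by
        rw [nthRootsFinset_def]
        exact (Multiset.toFinset_card_le _).trans (card_nthRoots _ _)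

/-- If `β` lies outside the prime field, the affine line through `1` and `β` over the prime field
meets the group generated by `β` in at most `(ord β + 1) / 2` points. -/
theorem two_mul_card_line_le [Fact p.Prime] {β : F} (hβ0 : β ≠ 0) (hβ1 : β ≠ 1)
    (hβ : ∀ γ : ZMod p, β ≠ γ.cast) (S : Finset F)
    (hS1 : ∀ x ∈ S, x ^ orderOf β = 1)
    (hS : ∀ x ∈ S, ∃ i : ZMod p, x = i.cast * (1 - β) + 1) :
    2 * S.card ≤ orderOf β + 1 := by
  have hinter : S ∩ S.image (β * ·) ⊆ {β} := by
    intro y hy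
    obtain ⟨hy, hy'⟩ := Finset.mem_inter.1 hy
    obtain ⟨x, hx, rfl⟩ := Finset.mem_image.1 hy'
    obtain ⟨i, rfl⟩ := hS x hx
    obtain ⟨j, hj⟩ := hS _ hy
    have h1 : (i.cast : F) * β = 1 + j.cast := by
      have : ((i.cast : F) * β - (1 + j.cast)) * (1 - β) = 0 := by linear_combination hj
      exact sub_eq_zero.1 ((mul_eq_zero.1 this).resolve_right (sub_ne_zero.2 hβ1.symm))
    by_cases hi : i = 0
    · simp [hi]
    · refine absurd ?_ (hβ ((1 + j) / i))
      have hi' : (i.cast : F) ≠ 0 := by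
        intro h
        apply hi
        apply (ZMod.castHom (dvd_refl p) F).injective
        simpa using h
      have h2 := map_div₀ (ZMod.castHom (dvd_refl p) F) (1 + j) i
      have h3 := map_add (ZMod.castHom (dvd_refl p) F) 1 j
      simp only [ZMod.castHom_apply, map_one] at h2 h3
      rw [h2, eq_div_iff hi', mul_comm, h1, h3]
  have hunion : S ∪ S.image (β * ·) ⊆ Finset.univ.filter fun x : F => x ^ orderOf β = 1 := by
    intro y hy
    rw [Finset.mem_filter]
    refine ⟨Finset.mem_univ _, ?_⟩
    rcases Finset.mem_union.1 hy with hy | hy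
    · exact hS1 y hy
    · obtain ⟨x, hx, rfl⟩ := Finset.mem_image.1 hy
      rw [mul_pow, pow_orderOf_eq_one, hS1 x hx, one_mul]
  have h1 := Finset.card_union_add_card_inter S (S.image (β * ·))
  rw [Finset.card_image_of_injective S (mul_right_injective₀ hβ0)] at h1
  have h2 := (Finset.card_le_card hunion).trans (card_filter_pow_orderOf_eq_one_le hβ0)
  have h3 := Finset.card_le_card hinter
  rw [Finset.card_singleton] at h3
  omega

theorem card_solutions_le_of_not_mem_primeField [Fact p.Prime] {β : F}
    (hβ0 : β ≠ 0) (hβ1 : β ≠ 1)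
    (hβ : ∀ γ : ZMod p, β ≠ γ.cast) :
    ((Finset.Ico 1 (Fintype.card F)).filter
      fun k : ℕ => β ^ (k + 1) = (k : F) * (1 - β) + 1).card ≤ Fintype.card F / p := by
  obtain ⟨n, hp, hq⟩ := FiniteField.card F p
  obtain ⟨m, hm⟩ : ∃ m, (n : ℕ) = m + 1 := Nat.exists_eq_succ_of_ne_zero n.ne_zero
  rw [hm, pow_succ] at hq
  have hM : Fintype.card F / p = p ^ m := by rw [hq, Nat.mul_div_cancel _ hp.pos]
  rw [hM]
  have hm0 : m ≠ 0 := by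
    rintro rfl
    have hbij := ZMod.castHom_bijective F (n := p) (by simpa using hq)
    obtain ⟨γ, hγ⟩ := hbij.2 β
    exact hβ γ (by simpa using hγ.symm)
  have hd : (orderOf β).Coprime p := coprime_orderOf_char hβ0
  have hd1 : orderOf β ≠ 1 := fun h => hβ1 (orderOf_eq_one_iff.1 h)
  have hd0 : orderOf β ≠ 0 := fun h => by
    rw [h] at hd
    exact hp.one_lt.ne' (by simpa using hd)
  set S : Finset F := Finset.univ.filter fun x : F =>
    x ^ orderOf β = 1 ∧ ∃ i : ZMod p, x = i.cast * (1 - β) + 1 with hSdef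
  have hL := two_mul_card_line_le (p := p) hβ0 hβ1 hβ S
    (fun x hx => (Finset.mem_filter.1 hx).2.1) (fun x hx => (Finset.mem_filter.1 hx).2.2)
  have hLp : S.card ≤ p := by
    have hsub : S ⊆ Finset.univ.image fun i : ZMod p => (i.cast : F) * (1 - β) + 1 := by
      intro x hx
      obtain ⟨i, hi⟩ := (Finset.mem_filter.1 hx).2.2
      exact Finset.mem_image.2 ⟨i, Finset.mem_univ _, hi.symm⟩
    calc S.card ≤ _ := Finset.card_le_card hsub
      _ ≤ _ := Finset.card_image_le
      _ = p := by rw [Finset.card_univ, ZMod.card]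
  have hcount := card_solutions_le (p := p) hβ1 hd
    ((Finset.Ico 1 (Fintype.card F)).filter
      fun k : ℕ => β ^ (k + 1) = (k : F) * (1 - β) + 1) S 0 (p ^ m / orderOf β + 1)
    (fun k hk => (Finset.mem_filter.1 hk).2)
    (fun k hk => by
      refine Finset.mem_filter.2 ⟨Finset.mem_univ _, ?_, (k : ZMod p), ?_⟩
      · rw [← pow_mul, mul_comm, pow_mul, pow_orderOf_eq_one, one_pow]
      · rw [ZMod.cast_natCast (dvd_refl p)]
        exact (Finset.mem_filter.1 hk).2)
    (fun _ _ => Nat.zero_le _)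
    (fun k hk => by
      have h1 := (Finset.mem_Ico.1 (Finset.mem_filter.1 hk).1).2
      have h2 := Nat.lt_mul_div_succ (p ^ m) (Nat.pos_of_ne_zero hd0)
      calc k < p * p ^ m := by rw [hq] at h1; linarith
        _ ≤ p * (orderOf β * (p ^ m / orderOf β + 1)) := Nat.mul_le_mul_left _ h2.le
        _ = _ := by ring)
  refine hcount.trans ?_
  have hdM : ¬ orderOf β ∣ p ^ m := fun h =>
    hd1 (Nat.Coprime.eq_one_of_dvd (hd.pow_right m) h)
  have hMdiv := Nat.div_add_mod (p ^ m) (orderOf β)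
  have hr : p ^ m % orderOf β ≠ 0 := fun h => hdM (Nat.dvd_of_mod_eq_zero h)
  rcases Nat.eq_zero_or_pos (p ^ m / orderOf β) with hc | hc
  · rw [hc, zero_add, mul_one]
    exact hLp.trans (Nat.le_self_pow hm0 p)
  · obtain ⟨c, hc⟩ := Nat.exists_eq_succ_of_ne_zero hc.ne'
    rw [hc] at hMdiv ⊢
    have h1 : S.card * c ≤ orderOf β * c := Nat.mul_le_mul_right _ (by omega)
    have h2 : 1 ≤ p ^ m % orderOf β := Nat.one_le_iff_ne_zero.2 hr
    rw [Nat.succ_eq_add_one] at *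
    linarith

theorem card_solutions_le_of_mem_primeField [Fact p.Prime] {γ : ZMod p}
    (hγ0 : γ ≠ 0) (hγ1 : γ ≠ 1) {β : F} (hβγ : β = γ.cast) :
    ((Finset.Ico 1 (Fintype.card F)).filter
      fun k : ℕ => β ^ (k + 1) = (k : F) * (1 - β) + 1).card ≤ Fintype.card F / p + nuP p := by
  have hinj := (ZMod.castHom (dvd_refl p) F).injective
  have hβ : β = ZMod.castHom (dvd_refl p) F γ := by rw [hβγ, ZMod.castHom_apply]
  have hβ0 : β ≠ 0 := by rw [hβ]; exact (_root_.map_ne_zero _).2 hγ0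
  have hβ1 : β ≠ 1 := fun h => hγ1 (hinj (by rw [← hβ, h, map_one]))
  obtain ⟨n, hp, hq⟩ := FiniteField.card F p
  obtain ⟨m, hm⟩ : ∃ m, (n : ℕ) = m + 1 := Nat.exists_eq_succ_of_ne_zero n.ne_zero
  rw [hm, pow_succ] at hq
  have hM : Fintype.card F / p = p ^ m := by rw [hq, Nat.mul_div_cancel _ hp.pos]
  have hd : (orderOf β).Coprime p := coprime_orderOf_char hβ0
  have hdvd : orderOf β ∣ p ^ m - 1 := by
    have h1 : orderOf β ∣ p - 1 := orderOf_dvd_of_pow_eq_one (by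
      rw [hβ, ← map_pow, ZMod.pow_card_sub_one_eq_one hγ0, map_one])
    exact h1.trans (by simpa using Nat.sub_dvd_pow_sub_pow p 1 m)
  obtain ⟨c, hc⟩ := hdvd
  have hpm : 1 ≤ p ^ m := Nat.one_le_pow _ _ hp.pos
  have htail := card_solutions_le (p := p) hβ1 hd
    ((Finset.Ico p (Fintype.card F)).filter
      fun k : ℕ => β ^ (k + 1) = (k : F) * (1 - β) + 1)
    (Finset.univ.filter fun x : F => x ^ orderOf β = 1) p c
    (fun k hk => (Finset.mem_filter.1 hk).2)
    (fun k hk => by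
      refine Finset.mem_filter.2 ⟨Finset.mem_univ _, ?_⟩
      rw [← pow_mul, mul_comm, pow_mul, pow_orderOf_eq_one, one_pow])
    (fun k hk => (Finset.mem_Ico.1 (Finset.mem_filter.1 hk).1).1)
    (fun k hk => by
      have h1 := (Finset.mem_Ico.1 (Finset.mem_filter.1 hk).1).2
      rw [mul_assoc, ← hc]
      calc k < p ^ m * p := hq ▸ h1
        _ = p + p * (p ^ m - 1) := by
          obtain ⟨M, hM⟩ := Nat.exists_eq_add_of_le hpm
          rw [hM, Nat.add_sub_cancel_left]
          ring)
  have htail' := htail.trans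
    (Nat.mul_le_mul_right c (card_filter_pow_orderOf_eq_one_le hβ0))
  rw [← hc] at htail'
  have hhead : ((Finset.Icc 1 (p - 2)).filter
      fun i : ℕ => γ ^ (i + 1) = (i : ZMod p) * (1 - γ) + 1).card ≤ nuP p :=
    Finset.le_sup (s := Finset.univ.erase (1 : ZMod p))
      (f := fun γ : ZMod p => ((Finset.Icc 1 (p - 2)).filter
        (fun i : ℕ => γ ^ (i + 1) = (i : ZMod p) * (1 - γ) + 1)).card)
      (Finset.mem_erase.2 ⟨hγ1, Finset.mem_univ _⟩)
  have hsub : (Finset.Ico 1 (Fintype.card F)).filter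
      (fun k : ℕ => β ^ (k + 1) = (k : F) * (1 - β) + 1) ⊆
      insert (p - 1) (((Finset.Icc 1 (p - 2)).filter
        fun i : ℕ => γ ^ (i + 1) = (i : ZMod p) * (1 - γ) + 1) ∪
      ((Finset.Ico p (Fintype.card F)).filter
        fun k : ℕ => β ^ (k + 1) = (k : F) * (1 - β) + 1)) := by
    intro k hk
    obtain ⟨hk, hsol⟩ := Finset.mem_filter.1 hk
    have hk := Finset.mem_Ico.1 hk
    rw [Finset.mem_insert, Finset.mem_union, Finset.mem_filter, Finset.mem_filter,
      Finset.mem_Icc, Finset.mem_Ico]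
    have hsol' : γ ^ (k + 1) = (k : ZMod p) * (1 - γ) + 1 := hinj (by
      rw [map_pow, map_add, map_mul, map_sub, map_one, map_natCast, ← hβ, hsol])
    rcases lt_trichotomy k (p - 1) with h | h | h
    · exact Or.inr (Or.inl ⟨by omega, hsol'⟩)
    · exact Or.inl h
    · exact Or.inr (Or.inr ⟨by omega, hsol⟩)
  have h1 := Finset.card_le_card hsub
  have h2 := Finset.card_insert_le (p - 1) (((Finset.Icc 1 (p - 2)).filter
        fun i : ℕ => γ ^ (i + 1) = (i : ZMod p) * (1 - γ) + 1) ∪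
      ((Finset.Ico p (Fintype.card F)).filter
        fun k : ℕ => β ^ (k + 1) = (k : F) * (1 - β) + 1))
  have h3 := Finset.card_union_le ((Finset.Icc 1 (p - 2)).filter
        fun i : ℕ => γ ^ (i + 1) = (i : ZMod p) * (1 - γ) + 1)
      ((Finset.Ico p (Fintype.card F)).filter
        fun k : ℕ => β ^ (k + 1) = (k : F) * (1 - β) + 1)
  omega

theorem card_solutions_lt [Fact p.Prime] {β : F} (hβ0 : β ≠ 0) (hβ1 : β ≠ 1) :
    ((Finset.Icc 1 (Fintype.card F - 2)).filter
      fun k : ℕ => β ^ (k + 1) = (k : F) * (1 - β) + 1).card <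
      Fintype.card F / p + nuP p := by
  have hle : ((Finset.Ico 1 (Fintype.card F)).filter
      fun k : ℕ => β ^ (k + 1) = (k : F) * (1 - β) + 1).card ≤ Fintype.card F / p + nuP p := by
    by_cases h : ∃ γ : ZMod p, β = γ.cast
    · obtain ⟨γ, hγ⟩ := h
      refine card_solutions_le_of_mem_primeField (γ := γ) ?_ ?_ hγ
      · rintro rfl
        exact hβ0 (by simpa using hγ)
      · rintro rfl
        exact hβ1 (by rw [hγ, ZMod.cast_one (dvd_refl p)])
    · push Not at h
      exact (card_solutions_le_of_not_mem_primeField hβ0 hβ1 h).trans (Nat.le_add_right _ _)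
  refine lt_of_lt_of_le (Finset.card_lt_card ?_) hle
  have hq : 1 < Fintype.card F := Fintype.one_lt_card
  refine (Finset.ssubset_iff_of_subset ?_).2 ⟨Fintype.card F - 1, ?_, ?_⟩
  · refine Finset.filter_subset_filter _ fun k hk => ?_
    rw [Finset.mem_Icc] at hk
    rw [Finset.mem_Ico]
    omega
  · rw [Finset.mem_filter, Finset.mem_Ico, Nat.sub_add_cancel hq.le, FiniteField.pow_card,
      Nat.cast_sub hq.le, FiniteField.cast_card_eq_zero]
    refine ⟨by omega, ?_⟩
    push_cast
    ring
  · rw [Finset.mem_filter, Finset.mem_Icc]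
    omega

end Counting

section Coefficients

variable {F : Type*} [Field F] [Fintype F]

theorem cast_choose_card_sub_one {k : ℕ} (hk : k ≤ Fintype.card F - 1) :
    ((Fintype.card F - 1).choose k : F) = (-1) ^ k := by
  obtain ⟨p, hchar⟩ := CharP.exists F
  obtain ⟨n, hp, hq⟩ := FiniteField.card F p
  have hq1 : 1 < Fintype.card F := Fintype.one_lt_card
  induction k with
  | zero => simp
  | succ k ih =>
    have h := Nat.choose_succ_succ (Fintype.card F - 1) k
    rw [Nat.succ_eq_add_one, Nat.sub_add_cancel hq1.le] at h
    have h0 : ((Fintype.card F).choose (k + 1) : F) = 0 := by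
      rw [CharP.cast_eq_zero_iff F p, hq]
      exact hp.dvd_choose_pow k.succ_ne_zero (by omega)
    rw [Nat.succ_eq_add_one] at h
    rw [h, Nat.cast_add, ih (by omega)] at h0
    rw [pow_succ]
    linear_combination h0

theorem cast_choose_card_sub_two {k : ℕ} (hk : k ≤ Fintype.card F - 2) :
    ((Fintype.card F - 2).choose k : F) = (-1) ^ k * (k + 1) := by
  have hq1 : 1 < Fintype.card F := Fintype.one_lt_card
  induction k with
  | zero => simp
  | succ k ih =>
    have h := Nat.choose_succ_succ (Fintype.card F - 2) k
    rw [Nat.succ_eq_add_one, Nat.succ_eq_add_one,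
      show Fintype.card F - 2 + 1 = Fintype.card F - 1 by omega] at h
    have h0 := cast_choose_card_sub_one (F := F) (k := k + 1) (by omega)
    rw [h, Nat.cast_add, ih (by omega)] at h0
    push_cast
    rw [pow_succ] at h0 ⊢
    linear_combination h0

theorem coeff_X_sub_C_pow_card_sub_one (t : F) {k : ℕ} (hk : k ≤ Fintype.card F - 1)
    (hodd : Odd (Fintype.card F)) :
    ((X - C t) ^ (Fintype.card F - 1)).coeff k = t ^ (Fintype.card F - 1 - k) := by
  have heven : Even (Fintype.card F - 1 - k + k) := by
    rw [Nat.sub_add_cancel hk]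
    exact Nat.Odd.sub_odd hodd odd_one
  rw [sub_eq_add_neg, ← C_neg, coeff_X_add_C_pow, cast_choose_card_sub_one hk,
    neg_pow, mul_right_comm, ← pow_add,
    heven.neg_one_pow, one_mul]

theorem coeff_X_sub_C_pow_card_sub_two (t : F) {k : ℕ} (hk : k ≤ Fintype.card F - 2)
    (hodd : Odd (Fintype.card F)) :
    ((X - C t) ^ (Fintype.card F - 2)).coeff k = -((k + 1) * t ^ (Fintype.card F - 2 - k)) := by
  have hq1 : 1 < Fintype.card F := Fintype.one_lt_card
  have hodd' : Odd (Fintype.card F - 2 - k + k) := by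
    rw [Nat.sub_add_cancel hk]
    exact Nat.Odd.sub_even (by omega) hodd even_two
  rw [sub_eq_add_neg, ← C_neg, coeff_X_add_C_pow, cast_choose_card_sub_two hk, neg_pow]
  linear_combination (t ^ (Fintype.card F - 2 - k) * (k + 1)) *
    (pow_add (-1 : F) (Fintype.card F - 2 - k) k).symm.trans hodd'.neg_one_pow

theorem pow_card_sub_two_eq_inv (hq : 2 < Fintype.card F) (x : F) :
    x ^ (Fintype.card F - 2) = x⁻¹ := by
  by_cases hx : x = 0
  · rw [hx, inv_zero, zero_pow (by omega)]
  · refine eq_inv_of_mul_eq_one_left ?_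
    rw [← pow_succ, show Fintype.card F - 2 + 1 = Fintype.card F - 1 by omega,
      FiniteField.pow_card_sub_one_eq_one x hx]

theorem modByMonic_X_pow_card_sub_X_eq {f g : F[X]} (hg : g.degree < Fintype.card F)
    (hfg : ∀ x, f.eval x = g.eval x) : f %ₘ (X ^ Fintype.card F - X) = g := by
  have hq1 : 1 < Fintype.card F := Fintype.one_lt_card
  have hdeg : (X ^ Fintype.card F - X : F[X]).degree = Fintype.card F := by
    rw [degree_sub_eq_left_of_degree_lt, degree_X_pow]
    rw [degree_X_pow, degree_X]
    exact_mod_cast hq1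
  have hmonic : (X ^ Fintype.card F - X : F[X]).Monic :=
    monic_X_pow_sub (by rw [degree_X]; exact_mod_cast hq1)
  have hlt := degree_modByMonic_lt f hmonic
  rw [hdeg] at hlt
  refine eq_of_degree_sub_lt_of_eval_finset_eq Finset.univ ?_ fun x _ => ?_
  · rw [Finset.card_univ]
    exact (degree_sub_le _ _).trans_lt (max_lt hlt hg)
  · have h := congrArg (eval x) (modByMonic_add_div f (X ^ Fintype.card F - X))
    simpa [FiniteField.pow_card, hfg] using h

/-- The reduced form of a Carlitz chain of length two, with `s` and `t` the two points at which it
differs from the associated Möbius map. -/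
theorem exists_modByMonic_eq_of_isCarlitzRep_two (hq : 2 < Fintype.card F) {f : F[X]}
    (hf : IsCarlitzRep (Fintype.card F) f 2) :
    ∃ a b s t : F, a ≠ 0 ∧ s ≠ t ∧ f %ₘ (X ^ Fintype.card F - X) =
      C b + C a * (C (t - s) * (X - C t) ^ (Fintype.card F - 2) -
        (X - C s) ^ (Fintype.card F - 1) + (X - C t) ^ (Fintype.card F - 1)) := by
  classical
  obtain ⟨a, ha0, ha, g, hg⟩ := hf
  have ha2 : a 2 ≠ 0 := ha 2 le_rfl le_rfl
  set s := -(a 1 / a 0) with hs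
  set t := s - 1 / (a 0 * a 2) with ht
  have hst : s ≠ t := by
    intro h
    have h2 : 1 / (a 0 * a 2) = 0 := by linear_combination h + ht
    exact one_div_ne_zero (mul_ne_zero ha0 ha2) h2
  refine ⟨(a 2)⁻¹, a 3 + (a 2)⁻¹, s, t, inv_ne_zero ha2, hst,
    modByMonic_X_pow_card_sub_X_eq ?_ fun x => ?_⟩
  · have hpow (u : F) (m : ℕ) : ((X - C u) ^ m).degree = (m : WithBot ℕ) := by
      rw [degree_pow, degree_X_sub_C, nsmul_one]
    rw [← mem_degreeLT]
    have hmem (u : F) {m : ℕ} (hm : m < Fintype.card F) :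
        (X - C u) ^ m ∈ degreeLT F (Fintype.card F) := by
      rw [mem_degreeLT, hpow]
      exact_mod_cast hm
    have hC (u : F) : C u ∈ degreeLT F (Fintype.card F) :=
      mem_degreeLT.2 (degree_C_le.trans_lt (by exact_mod_cast (by omega)))
    have hCmul (u : F) {h : F[X]} (hh : h ∈ degreeLT F (Fintype.card F)) :
        C u * h ∈ degreeLT F (Fintype.card F) := by
      rw [← smul_eq_C_mul]
      exact Submodule.smul_mem _ _ hh
    exact add_mem (hC _) (hCmul _ (add_mem (sub_mem (hCmul _ (hmem _ (by omega)))
      (hmem _ (by omega))) (hmem _ (by omega))))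
  · have hfx : f.eval x = ((a 0 * x + a 1)⁻¹ + a 2)⁻¹ + a 3 := by
      have := congrArg (eval x) hg
      simp only [carlitzChain, eval_sub, eval_add, eval_mul, eval_pow, eval_C, eval_X,
        FiniteField.pow_card, sub_self, zero_mul, pow_card_sub_two_eq_inv hq] at this
      exact sub_eq_zero.1 this
    simp only [hfx, eval_sub, eval_add, eval_mul, eval_pow, eval_C, eval_X,
      pow_card_sub_two_eq_inv hq]
    have hy : a 0 * x + a 1 = a 0 * (x - s) := by
      rw [hs]; field_simp; ring
    have hts : t - s = -(1 / (a 0 * a 2)) := by rw [ht]; ring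
    rw [hy]
    have h0 : (0 : F) ^ (Fintype.card F - 1) = 0 := zero_pow (by omega)
    by_cases hxs : x = s
    · have h1 : x - t ≠ 0 := by rw [hxs]; exact sub_ne_zero.2 hst
      rw [FiniteField.pow_card_sub_one_eq_one _ h1, hxs, sub_self, h0, mul_zero, inv_zero,
        ← neg_sub s t, neg_mul, mul_inv_cancel₀ (sub_ne_zero.2 hst)]
      ring
    have h1 : x - s ≠ 0 := sub_ne_zero.2 hxs
    rw [FiniteField.pow_card_sub_one_eq_one _ h1]
    by_cases hxt : x = t
    · rw [hxt, sub_self, h0, inv_zero, hts]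
      have h3 : (a 0 * -(1 / (a 0 * a 2)))⁻¹ = -a 2 := by field_simp
      rw [h3, neg_add_cancel, inv_zero]
      ring
    have h2 : x - t ≠ 0 := sub_ne_zero.2 hxt
    rw [FiniteField.pow_card_sub_one_eq_one _ h2, hts]
    have hxt' : x - t = (a 0 * a 2 * (x - s) + 1) / (a 0 * a 2) := by
      rw [ht]; field_simp; ring
    have h3 : a 0 * a 2 * (x - s) + 1 ≠ 0 := by
      intro h
      rw [h, zero_div] at hxt'
      exact h2 hxt'
    have h4 : (a 0 * (x - s))⁻¹ + a 2 = (a 0 * a 2 * (x - s) + 1) / (a 0 * (x - s)) := by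
      field_simp; ring
    rw [hxt', h4]
    field_simp
    ring

theorem coeff_reducedForm_eq_zero_iff {a b s t : F} (ha : a ≠ 0) (hodd : Odd (Fintype.card F))
    {k : ℕ} (hk : k ∈ Finset.Icc 1 (Fintype.card F - 2)) :
    (C b + C a * (C (t - s) * (X - C t) ^ (Fintype.card F - 2) -
        (X - C s) ^ (Fintype.card F - 1) + (X - C t) ^ (Fintype.card F - 1))).coeff k = 0 ↔
      (s - t) * (k + 1) * t ^ (Fintype.card F - 2 - k) - s ^ (Fintype.card F - 1 - k)
        + t ^ (Fintype.card F - 1 - k) = 0 := by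
  rw [Finset.mem_Icc] at hk
  rw [coeff_add, coeff_C_of_ne_zero (by omega), zero_add, coeff_C_mul, coeff_add, coeff_sub,
    coeff_C_mul, coeff_X_sub_C_pow_card_sub_two t hk.2 hodd,
    coeff_X_sub_C_pow_card_sub_one s (by omega) hodd,
    coeff_X_sub_C_pow_card_sub_one t (by omega) hodd, mul_eq_zero_iff_left ha]
  rw [show (t - s) * -(((k : F) + 1) * t ^ (Fintype.card F - 2 - k)) =
    (s - t) * (k + 1) * t ^ (Fintype.card F - 2 - k) by ring]

theorem card_vanishing_coeff_lt [DecidableEq F] {p : ℕ} [Fact p.Prime] [CharP F p]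
    (hodd : Odd (Fintype.card F)) {s t : F} (hst : s ≠ t) :
    ((Finset.Icc 1 (Fintype.card F - 2)).filter fun k : ℕ =>
      (s - t) * (k + 1) * t ^ (Fintype.card F - 2 - k) - s ^ (Fintype.card F - 1 - k)
        + t ^ (Fintype.card F - 1 - k) = 0).card < Fintype.card F / p + nuP p := by
  have hq1 : 1 < Fintype.card F := Fintype.one_lt_card
  obtain ⟨n, hp, hq⟩ := FiniteField.card F p
  have hpq : p ∣ Fintype.card F := hq ▸ dvd_pow_self p n.ne_zero
  have hpos : 0 < Fintype.card F / p := Nat.div_pos (Nat.le_of_dvd (by omega) hpq) hp.pos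
  by_cases ht : t = 0
  · subst ht
    rw [Finset.filter_eq_empty_iff.2, Finset.card_empty]
    · omega
    intro k hk h
    rw [Finset.mem_Icc] at hk
    rw [zero_pow (M₀ := F) (n := Fintype.card F - 1 - k) (by omega)] at h
    rcases hk.2.lt_or_eq with hlt | rfl
    · rw [zero_pow (by omega), mul_zero, zero_sub, add_zero, neg_eq_zero] at h
      exact hst (eq_zero_of_pow_eq_zero h)
    · rw [Nat.sub_self, show Fintype.card F - 1 - (Fintype.card F - 2) = 1 by omega,
        Nat.cast_sub (by omega), FiniteField.cast_card_eq_zero] at h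
      have h2 : (2 : F) * s = 0 := by
        push_cast at h
        linear_combination -h
      have h2' : (2 : F) ≠ 0 := Ring.two_ne_zero fun h =>
        (Nat.not_even_iff_odd.2 hodd) (FiniteField.even_card_of_char_two h |> Nat.even_iff.2)
      exact hst ((mul_eq_zero.1 h2).resolve_left h2')
  have hpow {k : ℕ} (hk : k ≤ Fintype.card F - 2) :
      t ^ (Fintype.card F - 1 - k) = t ^ (Fintype.card F - 2 - k) * t := by
    rw [← pow_succ]
    congr 1
    omega
  by_cases hs : s = 0
  · subst hs
    refine lt_of_le_of_lt (b := (Fintype.card F - 1) / p) ?_ ?_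
    · rw [← Nat.Ioc_filter_dvd_card_eq_div]
      refine Finset.card_le_card fun k hk => ?_
      obtain ⟨hk, h⟩ := Finset.mem_filter.1 hk
      rw [Finset.mem_Icc] at hk
      rw [Finset.mem_filter, Finset.mem_Ioc]
      refine ⟨by omega, (CharP.cast_eq_zero_iff F p k).1 ?_⟩
      rw [zero_pow (M₀ := F) (n := Fintype.card F - 1 - k) (by omega), hpow hk.2] at h
      have h' : (k : F) * (t ^ (Fintype.card F - 2 - k) * t) = 0 := by linear_combination -h
      exact (mul_eq_zero.1 h').resolve_right (mul_ne_zero (pow_ne_zero _ ht) ht)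
    · refine lt_of_lt_of_le (Nat.div_lt_of_lt_mul ?_) (Nat.le_add_right _ _)
      rw [Nat.mul_div_cancel' hpq]
      omega
  refine lt_of_le_of_lt (Finset.card_le_card fun k hk => ?_)
    (card_solutions_lt (p := p) (div_ne_zero ht hs)
      fun h => hst ((div_eq_one_iff_eq hs).1 h).symm)
  obtain ⟨hk, h⟩ := Finset.mem_filter.1 hk
  refine Finset.mem_filter.2 ⟨hk, ?_⟩
  rw [Finset.mem_Icc] at hk
  have hinv {u : F} (hu : u ≠ 0) : u ^ (Fintype.card F - 1 - k) * u ^ k = 1 := by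
    rw [← pow_add, Nat.sub_add_cancel (by omega), FiniteField.pow_card_sub_one_eq_one u hu]
  have hs1 := hinv hs
  have ht1 := hinv ht
  rw [hpow hk.2] at h ht1
  rw [div_pow, div_eq_iff (pow_ne_zero _ hs), pow_succ, pow_succ]
  field_simp
  linear_combination -(t ^ k * t * s ^ k) * h +
    ((s - t) * (k + 1) * s ^ k + t * s ^ k) * ht1 - t * t ^ k * hs1

end Coefficients

/-- **Corollary.** Let `p` be an odd prime and `F` a finite field of characteristic `p`
with `q` elements. If `f` is a permutation polynomial of `F` with Carlitz rank 2, then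
`ω(f) ≥ q - q/p - 1 - ν_p`. -/
theorem weight_ge_of_carlitzRank_two_nuP {p : ℕ} [Fact p.Prime] (hp : Odd p)
    {F : Type*} [Field F] [Fintype F] [CharP F p] (f : F[X])
    (hperm : Function.Bijective fun x : F => f.eval x)
    (hrank : carlitzRank (Fintype.card F) f = 2) :
    (polyWeight (Fintype.card F) f : ℝ) ≥
      (Fintype.card F : ℝ) - (Fintype.card F : ℝ) / p - 1 - nuP p := by
  classical
  obtain ⟨n, hprime, hq⟩ := FiniteField.card F p
  have hodd : Odd (Fintype.card F) := hq ▸ hp.pow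
  have hq2 : 2 < Fintype.card F := by
    have h1 : 1 < Fintype.card F := Fintype.one_lt_card
    obtain ⟨m, hm⟩ := hodd
    omega
  have hrep : IsCarlitzRep (Fintype.card F) f 2 := by
    have hne : {n | IsCarlitzRep (Fintype.card F) f n}.Nonempty :=
      Nat.nonempty_of_pos_sInf (by
        change 0 < carlitzRank (Fintype.card F) f
        omega)
    have h := Nat.sInf_mem hne
    change IsCarlitzRep (Fintype.card F) f (carlitzRank (Fintype.card F) f) at h
    rwa [hrank] at h
  obtain ⟨a, b, s, t, ha, hst, hmod⟩ := exists_modByMonic_eq_of_isCarlitzRep_two hq2 hrep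
  have hlt := card_vanishing_coeff_lt (p := p) hodd hst
  set Z := (Finset.Icc 1 (Fintype.card F - 2)).filter fun k : ℕ =>
      (s - t) * (k + 1) * t ^ (Fintype.card F - 2 - k) - s ^ (Fintype.card F - 1 - k)
        + t ^ (Fintype.card F - 1 - k) = 0
  have hsub : Finset.Icc 1 (Fintype.card F - 2) ⊆
      (f %ₘ (X ^ Fintype.card F - X)).support ∪ Z := by
    intro k hk
    rw [Finset.mem_union, mem_support_iff, hmod, Ne, coeff_reducedForm_eq_zero_iff ha hodd hk,
      Finset.mem_filter]
    tauto
  have hle := (Finset.card_le_card hsub).trans (Finset.card_union_le _ _)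
  rw [Nat.card_Icc] at hle
  have hdiv : ((Fintype.card F / p : ℕ) : ℝ) = (Fintype.card F : ℝ) / p :=
    Nat.cast_div (hq ▸ dvd_pow_self p n.ne_zero) (by exact_mod_cast hprime.ne_zero)
  have hmain : Fintype.card F ≤
      polyWeight (Fintype.card F) f + Fintype.card F / p + nuP p + 1 := by
    unfold polyWeight
    omega
  rw [← hdiv]
  have hmain' : (Fintype.card F : ℝ) ≤ polyWeight (Fintype.card F) f +
      (Fintype.card F / p : ℕ) + nuP p + 1 := by exact_mod_cast hmain
  linarith
end

section
/- Let f be a permutation polynomial of F_q, reduced modulo x^q − x, with deg(f) ≥ 2, and suppose f is not of the form c_1 + c_2 x^{q−2} with c_1, c_2 ∈ F_q, c_2 ≠ 0. Then Crk(f) > q/(ω(f) + 2) − 1, where ω(f) is the number of nonzero coefficients of f. -/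
open Polynomial

section CarlitzChain

variable {F : Type*} [Field F]

theorem carlitzChain_congr (q : ℕ) {a b : ℕ → F} {n : ℕ} (h : ∀ i ≤ n + 1, a i = b i) :
    carlitzChain q a n = carlitzChain q b n := by
  induction n with
  | zero => simp [carlitzChain, h 0, h 1]
  | succ n ih => simp [carlitzChain, ih fun i hi => h i (by omega), h (n + 2) le_rfl]

/-- The map `t ↦ 1 - t⁻¹` has order three on the projective line, so with the convention
`0⁻¹ = 0` its third iterate swaps `0` and `1`. -/
theorem one_sub_inv_iterate_three [DecidableEq F] (t : F) :
    1 - (1 - (1 - t⁻¹)⁻¹)⁻¹ = Equiv.swap 0 1 t := by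
  rcases eq_or_ne t 0 with rfl | h0
  · simp
  rcases eq_or_ne t 1 with rfl | h1
  · simp
  rw [Equiv.swap_apply_of_ne_of_ne h0 h1]
  have h2 : t - 1 ≠ 0 := sub_ne_zero.2 h1
  have e1 : 1 - t⁻¹ = (t - 1) / t := by field_simp
  have e2 : 1 - ((t - 1) / t)⁻¹ = -1 / (t - 1) := by field_simp; ring
  rw [e1, e2]
  field_simp
  ring

variable [Fintype F]

theorem pow_card_sub_two (hq : 3 ≤ Fintype.card F) (x : F) :
    x ^ (Fintype.card F - 2) = x⁻¹ := by
  rcases eq_or_ne x 0 with rfl | hx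
  · rw [inv_zero, zero_pow (by omega)]
  · apply eq_inv_of_mul_eq_one_left
    rw [← pow_succ, show Fintype.card F - 2 + 1 = Fintype.card F - 1 by omega]
    exact FiniteField.pow_card_sub_one_eq_one x hx

theorem eval_carlitzChain_succ (hq : 3 ≤ Fintype.card F) (a : ℕ → F) (n : ℕ) (x : F) :
    (carlitzChain (Fintype.card F) a (n + 1)).eval x =
      ((carlitzChain (Fintype.card F) a n).eval x)⁻¹ + a (n + 2) := by
  simp [carlitzChain, pow_card_sub_two hq]

theorem monic_X_pow_card_sub_X : (X ^ Fintype.card F - X : F[X]).Monic :=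
  monic_X_pow_sub (by
    rw [degree_X]
    exact_mod_cast Fintype.one_lt_card)

theorem X_pow_card_sub_X_dvd_iff (p : F[X]) :
    (X ^ Fintype.card F - X : F[X]) ∣ p ↔ ∀ x, p.eval x = 0 := by
  constructor
  · rintro ⟨r, rfl⟩ x
    simp [FiniteField.pow_card]
  · intro h
    rw [← modByMonic_eq_zero_iff_dvd monic_X_pow_card_sub_X]
    refine eq_zero_of_natDegree_lt_card_of_eval_eq_zero _ (f := id) Function.injective_id
      (fun x => ?_) ?_
    · have := congrArg (eval x) (modByMonic_add_div p (X ^ Fintype.card F - X : F[X]))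
      simpa [FiniteField.pow_card, h] using this
    · have hdeg := FiniteField.X_pow_card_sub_X_natDegree_eq F (Fintype.one_lt_card (α := F))
      refine (natDegree_modByMonic_lt p monic_X_pow_card_sub_X fun h1 => ?_).trans_eq hdeg
      rw [h1, natDegree_one] at hdeg
      have := Fintype.one_lt_card (α := F)
      omega

/-- `φ` is the function induced by a Carlitz chain of some length. -/
def IsCarlitzFun (φ : F → F) : Prop :=
  ∃ (n : ℕ) (a : ℕ → F), a 0 ≠ 0 ∧ (∀ i, 2 ≤ i → i ≤ n → a i ≠ 0) ∧
    ∀ x, (carlitzChain (Fintype.card F) a n).eval x = φ x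

namespace IsCarlitzFun

theorem id : IsCarlitzFun fun x : F => x :=
  ⟨0, fun i => if i = 0 then 1 else 0, by simp, fun i h2 h0 => by omega,
    fun x => by simp [carlitzChain]⟩

theorem add_const (hq : 3 ≤ Fintype.card F) {φ : F → F} (h : IsCarlitzFun φ) (c : F) :
    IsCarlitzFun fun x => φ x + c := by
  obtain ⟨n, a, h0, hne, hφ⟩ := h
  refine ⟨n, Function.update a (n + 1) (a (n + 1) + c), ?_, fun i h2 hi => ?_, fun x => ?_⟩
  · simpa using h0
  · rw [Function.update_of_ne (by omega)]
    exact hne i h2 hi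
  · simp only [← hφ]
    cases n with
    | zero => simp [carlitzChain, add_assoc]
    | succ n =>
      rw [eval_carlitzChain_succ hq, eval_carlitzChain_succ hq,
        carlitzChain_congr _ fun i (hi : i ≤ n + 1) =>
          Function.update_of_ne (show i ≠ n + 1 + 1 by omega) _ a]
      simp [add_assoc]

theorem inv (hq : 3 ≤ Fintype.card F) {φ : F → F} (h : IsCarlitzFun φ) :
    IsCarlitzFun fun x => (φ x)⁻¹ := by
  obtain ⟨n, a, h0, hne, hφ⟩ := h
  by_cases hn : n = 0 ∨ a (n + 1) ≠ 0
  · refine ⟨n + 1, Function.update a (n + 2) 0, ?_, fun i h2 hi => ?_, fun x => ?_⟩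
    · simpa using h0
    · rw [Function.update_of_ne (by omega)]
      rcases Nat.lt_or_ge n i with h | h
      · obtain rfl : i = n + 1 := by omega
        exact hn.resolve_left (by omega)
      · exact hne i h2 h
    · simp only [← hφ]
      rw [eval_carlitzChain_succ hq,
        carlitzChain_congr _ fun i (hi : i ≤ n + 1) =>
          Function.update_of_ne (show i ≠ n + 2 by omega) _ a]
      simp
  · push Not at hn
    obtain ⟨m, rfl⟩ := Nat.exists_eq_succ_of_ne_zero hn.1
    refine ⟨m, a, h0, fun i h2 hi => hne i h2 (by omega), fun x => ?_⟩
    simp only [← hφ]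
    rw [Nat.succ_eq_add_one, eval_carlitzChain_succ hq, hn.2, add_zero, inv_inv]

theorem exists_eval_eq_const_mul (hq : 3 ≤ Fintype.card F) (a : ℕ → F) (n : ℕ) :
    ∀ c : F, c ≠ 0 → ∃ b : ℕ → F, (∀ i, b i = 0 ↔ a i = 0) ∧
      ∀ x, (carlitzChain (Fintype.card F) b n).eval x =
        c * (carlitzChain (Fintype.card F) a n).eval x := by
  induction n with
  | zero =>
    intro c hc
    exact ⟨fun i => c * a i, fun i => by simp [hc], fun x => by simp [carlitzChain]; ring⟩
  | succ n ih =>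
    intro c hc
    obtain ⟨b, hb, hbx⟩ := ih c⁻¹ (inv_ne_zero hc)
    refine ⟨Function.update b (n + 2) (c * a (n + 2)), fun i => ?_, fun x => ?_⟩
    · rcases eq_or_ne i (n + 2) with rfl | hi
      · simp [hc]
      · simpa [hi] using hb i
    · rw [eval_carlitzChain_succ hq, eval_carlitzChain_succ hq,
        carlitzChain_congr _ fun i (hi : i ≤ n + 1) =>
          Function.update_of_ne (show i ≠ n + 2 by omega) _ b, hbx]
      simp only [mul_inv_rev, inv_inv, Function.update_self]
      ring

theorem const_mul (hq : 3 ≤ Fintype.card F) {φ : F → F} (h : IsCarlitzFun φ) {c : F}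
    (hc : c ≠ 0) : IsCarlitzFun fun x => c * φ x := by
  obtain ⟨n, a, h0, hne, hφ⟩ := h
  obtain ⟨b, hb, hbx⟩ := exists_eval_eq_const_mul hq a n c hc
  exact ⟨n, b, (hb 0).not.2 h0, fun i h2 hi => (hb i).not.2 (hne i h2 hi),
    fun x => by rw [hbx, hφ]⟩

theorem one_sub_inv (hq : 3 ≤ Fintype.card F) {φ : F → F} (h : IsCarlitzFun φ) :
    IsCarlitzFun fun x => 1 - (φ x)⁻¹ := by
  convert ((h.inv hq).const_mul hq (neg_ne_zero.2 one_ne_zero)).add_const hq 1 using 2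
  ring

theorem swap_comp [DecidableEq F] (hq : 3 ≤ Fintype.card F) {φ : F → F} (h : IsCarlitzFun φ)
    {a b : F} (hab : a ≠ b) : IsCarlitzFun fun x => Equiv.swap a b (φ x) := by
  have hba : b - a ≠ 0 := sub_ne_zero.2 hab.symm
  have key := ((((((h.add_const hq (-a)).const_mul hq (inv_ne_zero hba)).one_sub_inv
    hq).one_sub_inv hq).one_sub_inv hq).const_mul hq hba).add_const hq a
  convert key using 2 with x
  rw [one_sub_inv_iterate_three]
  simp only [Equiv.swap_apply_def, mul_eq_zero, inv_eq_zero, hba, false_or,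
    inv_mul_eq_one₀ hba, ← sub_eq_add_neg, sub_eq_zero, sub_left_inj]
  by_cases h1 : φ x = a
  · simp [h1]
  · by_cases h2 : φ x = b
    · simp [h2, hab.symm]
    · simp [h1, h2, Ne.symm h2, hba]

theorem of_perm (hq : 3 ≤ Fintype.card F) (σ : Equiv.Perm F) : IsCarlitzFun σ := by
  classical
  refine Equiv.Perm.swap_induction_on σ IsCarlitzFun.id fun τ a b hab hτ => ?_
  exact hτ.swap_comp hq hab

end IsCarlitzFun

/-- Carlitz's theorem: every permutation polynomial has a Carlitz representation. -/
theorem exists_isCarlitzRep (hq : 3 ≤ Fintype.card F) {f : F[X]}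
    (hf : Function.Bijective fun x : F => f.eval x) :
    ∃ n, IsCarlitzRep (Fintype.card F) f n := by
  obtain ⟨n, a, h0, hne, ha⟩ := IsCarlitzFun.of_perm hq (Equiv.ofBijective _ hf)
  refine ⟨n, a, h0, hne, (X_pow_card_sub_X_dvd_iff _).2 fun x => ?_⟩
  simp [ha]

/-- A Carlitz chain of length `n` is a Möbius transformation off at most `n` points. -/
theorem exists_mobius_eq_carlitzChain (hq : 3 ≤ Fintype.card F) {a : ℕ → F} (h0 : a 0 ≠ 0)
    (n : ℕ) : ∃ (α β γ δ : F) (S : Finset F), α * δ - β * γ ≠ 0 ∧ S.card ≤ n ∧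
      ∀ x ∉ S, γ * x + δ ≠ 0 ∧
        (carlitzChain (Fintype.card F) a n).eval x = (α * x + β) / (γ * x + δ) := by
  classical
  induction n with
  | zero => exact ⟨a 0, a 1, 0, 1, ∅, by simpa, by simp, by simp [carlitzChain]⟩
  | succ n ih =>
    obtain ⟨α, β, γ, δ, S, hdet, hS, h⟩ := ih
    refine ⟨γ + a (n + 2) * α, δ + a (n + 2) * β, α, β, insert (-β / α) S, ?_,
      (Finset.card_insert_le _ _).trans (by omega), fun x hx => ?_⟩
    · contrapose! hdet
      linear_combination -hdet
    · rw [Finset.mem_insert, not_or] at hx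
      have hne : α * x + β ≠ 0 := by
        intro h1
        rcases eq_or_ne α 0 with rfl | hα
        · apply hdet
          linear_combination -γ * h1
        · apply hx.1
          field_simp
          linear_combination h1
      refine ⟨hne, ?_⟩
      rw [eval_carlitzChain_succ hq, (h x hx.2).2]
      have := (h x hx.2).1
      field_simp
      ring

end CarlitzChain

section SparsePolynomial

variable {F : Type*} [Field F]

/-- The monic polynomial whose roots are `θ ^ e`, for `e` an exponent occurring in `f`. -/
noncomputable def exponentPoly (θ : F) (f : F[X]) : F[X] :=
  ∏ e ∈ f.support, (X - C (θ ^ e))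

theorem exponentPoly_monic (θ : F) (f : F[X]) : (exponentPoly θ f).Monic :=
  monic_prod_of_monic _ _ fun _ _ => monic_X_sub_C _

theorem natDegree_exponentPoly (θ : F) (f : F[X]) :
    (exponentPoly θ f).natDegree = f.support.card := by
  rw [exponentPoly, natDegree_prod_of_monic _ _ fun _ _ => monic_X_sub_C _]
  simp_rw [natDegree_X_sub_C]
  simp

theorem coeff_card_support_exponentPoly (θ : F) (f : F[X]) :
    (exponentPoly θ f).coeff f.support.card = 1 := by
  rw [← natDegree_exponentPoly θ f]
  exact exponentPoly_monic θ f

/-- The values of `f` along a geometric progression satisfy a linear recurrence whose order is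
the number of terms of `f`. -/
theorem sum_coeff_exponentPoly_mul_eval (θ : F) (f : F[X]) (x : F) :
    ∑ j ∈ Finset.range (f.support.card + 1),
      (exponentPoly θ f).coeff j * f.eval (θ ^ j * x) = 0 := by
  have hroot : ∀ e ∈ f.support,
      ∑ j ∈ Finset.range (f.support.card + 1), (exponentPoly θ f).coeff j * (θ ^ e) ^ j = 0 := by
    intro e he
    rw [← natDegree_exponentPoly θ f, ← eval_eq_sum_range, exponentPoly, eval_prod]
    exact Finset.prod_eq_zero he (by simp)
  calc _ = ∑ e ∈ f.support, f.coeff e * x ^ e *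
        ∑ j ∈ Finset.range (f.support.card + 1),
          (exponentPoly θ f).coeff j * (θ ^ e) ^ j := by
        simp_rw [eval_eq_sum (p := f), sum_def, Finset.mul_sum]
        rw [Finset.sum_comm]
        refine Finset.sum_congr rfl fun e _ => Finset.sum_congr rfl fun j _ => ?_
        rw [mul_pow, ← pow_mul, ← pow_mul, mul_comm j e]
        ring
    _ = 0 := Finset.sum_eq_zero fun e he => by rw [hroot e he, mul_zero]

variable [Fintype F]

theorem exists_orderOf_eq_card_sub_one :
    ∃ θ : F, θ ≠ 0 ∧ orderOf θ = Fintype.card F - 1 ∧ ∀ x : F, x ≠ 0 → ∃ k : ℕ, θ ^ k = x := by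
  obtain ⟨g, hg⟩ := IsCyclic.exists_monoid_generator (α := Fˣ)
  refine ⟨g, g.ne_zero, ?_, fun x hx => ?_⟩
  · classical
    rw [orderOf_units, orderOf_eq_card_of_forall_mem_powers hg, Nat.card_eq_fintype_card,
      Fintype.card_units]
  · obtain ⟨k, hk⟩ := hg (Units.mk0 x hx)
    exact ⟨k, by simpa using congrArg Units.val hk⟩

/-- A polynomial that does not vanish on the multiplicative group has at least
`(q - 1) / w` nonzero values, where `w` is its number of terms. -/
theorem card_sub_one_le_card_support_mul {h : F[X]} {x₀ : F} (hx₀ : x₀ ≠ 0)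
    (hne : h.eval x₀ ≠ 0) {S : Finset F} (hS : ∀ x, h.eval x ≠ 0 → x ∈ S) :
    Fintype.card F - 1 ≤ h.support.card * S.card := by
  classical
  obtain ⟨θ, hθ0, -, hθ⟩ := exists_orderOf_eq_card_sub_one (F := F)
  have hex : ∀ x : F, x ≠ 0 → ∃ j < h.support.card, h.eval (θ ^ j * x) ≠ 0 := by
    intro x hx
    by_contra! hzero
    have hall : ∀ k, h.eval (θ ^ k * x) = 0 := by
      intro k
      induction k using Nat.strong_induction_on with
      | _ k ih =>
        rcases Nat.lt_or_ge k h.support.card with hk | hk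
        · exact hzero k hk
        · obtain ⟨m, rfl⟩ := Nat.exists_eq_add_of_le' hk
          have hrec := sum_coeff_exponentPoly_mul_eval θ h (θ ^ m * x)
          rw [Finset.sum_range_succ, coeff_card_support_exponentPoly, one_mul,
            Finset.sum_eq_zero, zero_add, ← mul_assoc, ← pow_add, add_comm] at hrec
          · exact hrec
          · intro j hj
            rw [← mul_assoc, ← pow_add, ih _ (by rw [Finset.mem_range] at hj; omega), mul_zero]
    obtain ⟨k, hk⟩ := hθ (x₀ / x) (div_ne_zero hx₀ hx)
    apply hne
    simpa [hk, hx] using hall k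
  have hsub : Finset.univ.erase (0 : F) ⊆ (Finset.range h.support.card).biUnion fun j =>
      S.image fun y => (θ ^ j)⁻¹ * y := by
    intro x hx
    obtain ⟨j, hj, hjx⟩ := hex x (Finset.ne_of_mem_erase hx)
    simp only [Finset.mem_biUnion, Finset.mem_image]
    exact ⟨j, Finset.mem_range.2 hj, θ ^ j * x, hS _ hjx,
      inv_mul_cancel_left₀ (pow_ne_zero _ hθ0) _⟩
  calc Fintype.card F - 1 = (Finset.univ.erase (0 : F)).card := by simp
    _ ≤ _ := Finset.card_le_card hsub
    _ ≤ (Finset.range h.support.card).card * S.card :=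
        Finset.card_biUnion_le_card_mul _ _ _ fun _ _ => Finset.card_image_le
    _ = _ := by rw [Finset.card_range]

/-- Two distinct permutation polynomials of degree less than `q` whose difference is sparse
differ at many points. -/
theorem card_sub_one_le_of_perm {f g : F[X]} (hf : Function.Injective fun x : F => f.eval x)
    (hg : Function.Surjective fun x : F => g.eval x) (hfd : f.natDegree < Fintype.card F)
    (hgd : g.natDegree < Fintype.card F) (hfg : f ≠ g) {S : Finset F}
    (hS : ∀ x ∉ S, f.eval x = g.eval x) :
    Fintype.card F - 1 ≤ (f.support.card + g.support.card) * S.card := by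
  classical
  have hdiff : ∃ x₀ : F, x₀ ≠ 0 ∧ (f - g).eval x₀ ≠ 0 := by
    by_contra! hall
    have heq : ∀ x : F, x ≠ 0 → f.eval x = g.eval x := fun x hx => by
      simpa [sub_eq_zero] using hall x hx
    apply hfg
    refine eq_of_natDegree_lt_card_of_eval_eq f g (f := id) Function.injective_id (fun x => ?_)
      (max_lt hfd hgd)
    rcases eq_or_ne x 0 with rfl | hx
    · obtain ⟨y, hy⟩ := hg (f.eval 0)
      rcases eq_or_ne y 0 with rfl | hy0
      · exact hy.symm
      · exact absurd (hf ((heq y hy0).trans hy)) hy0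
    · exact heq x hx
  obtain ⟨x₀, hx₀, hne⟩ := hdiff
  refine (card_sub_one_le_card_support_mul hx₀ hne (S := S) fun x hx => ?_).trans
    (Nat.mul_le_mul_right _ ?_)
  · by_contra hxS
    exact hx (by rw [eval_sub, hS x hxS, sub_self])
  · refine (Finset.card_le_card fun i hi => ?_).trans (Finset.card_union_le _ _)
    rw [Finset.mem_union, mem_support_iff, mem_support_iff]
    by_contra! h
    simp [h.1, h.2] at hi

/-- A sparse polynomial differs at many points from any Möbius transformation whose pole is
neither `0` nor `∞`. -/
theorem card_le_of_eval_eq_mobius {f : F[X]} {α β γ δ : F} (hdet : α * δ - β * γ ≠ 0)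
    (hγ : γ ≠ 0) (hδ : δ ≠ 0) (hw : f.support.card + 1 < Fintype.card F) {S : Finset F}
    (hS : ∀ x ∉ S, γ * x + δ ≠ 0 ∧ f.eval x = (α * x + β) / (γ * x + δ)) :
    Fintype.card F ≤ (f.support.card + 1) * (S.card + 1) := by
  classical
  obtain ⟨θ, hθ0, hord, -⟩ := exists_orderOf_eq_card_sub_one (F := F)
  set w := f.support.card with hwdef
  let R := Finset.range (w + 1)
  let N : F[X] := ∑ j ∈ R, C ((exponentPoly θ f).coeff j) * (C (α * θ ^ j) * X + C β) *
    ∏ k ∈ R.erase j, (C (γ * θ ^ k) * X + C δ)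
  have hNdeg : N.natDegree ≤ w + 1 := by
    refine natDegree_sum_le_of_forall_le _ _ fun j hj => ?_
    refine natDegree_mul_le.trans ?_
    have h1 : (C ((exponentPoly θ f).coeff j) * (C (α * θ ^ j) * X + C β)).natDegree ≤ 1 :=
      (natDegree_C_mul_le _ _).trans natDegree_linear_le
    have h2 : (∏ k ∈ R.erase j, (C (γ * θ ^ k) * X + C δ)).natDegree ≤ w :=
      (natDegree_prod_le _ _).trans <|
        (Finset.sum_le_card_nsmul _ _ 1 fun k _ => natDegree_linear_le).trans <| by
          simp [Finset.card_erase_of_mem hj, R]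
    omega
  have hNne : N ≠ 0 := by
    intro hN
    have hx := congrArg (eval (-δ / (γ * θ ^ w))) hN
    have hθw : θ ^ w ≠ 0 := pow_ne_zero _ hθ0
    have hwR : w ∈ R := Finset.self_mem_range_succ w
    rw [eval_finsetSum, Finset.sum_eq_single_of_mem w hwR, eval_zero] at hx
    · simp only [eval_mul, eval_C, eval_add, eval_X, eval_prod, mul_eq_zero,
        coeff_card_support_exponentPoly, hwdef, one_ne_zero, false_or] at hx
      rw [← hwdef, Finset.prod_eq_zero_iff] at hx
      rcases hx with hx | ⟨k, hk, hx⟩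
      · apply hdet
        field_simp at hx
        linear_combination -hx
      · rw [Finset.mem_erase, Finset.mem_range] at hk
        have hpow : θ ^ k = θ ^ w := by
          field_simp at hx
          have := (mul_eq_zero.1 (hx.trans (mul_zero _))).resolve_left hδ
          linear_combination -this
        exact hk.1 (pow_injOn_Iio_orderOf (by rw [Set.mem_Iio]; omega)
          (by rw [Set.mem_Iio]; omega) hpow)
    · intro j _ hj
      rw [eval_mul, eval_prod, Finset.prod_eq_zero (i := w) (Finset.mem_erase.2 ⟨hj.symm, hwR⟩),
        mul_zero]
      simp only [eval_add, eval_mul, eval_C, eval_X]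
      field_simp
      ring
  have hroot : ∀ x : F, (∀ j ∈ R, θ ^ j * x ∉ S) → N.eval x = 0 := by
    intro x hx
    have hprod : N.eval x = (∏ k ∈ R, (γ * (θ ^ k * x) + δ)) *
        ∑ j ∈ R, (exponentPoly θ f).coeff j * f.eval (θ ^ j * x) := by
      rw [eval_finsetSum, Finset.mul_sum]
      refine Finset.sum_congr rfl fun j hj => ?_
      obtain ⟨hne, hval⟩ := hS _ (hx j hj)
      rw [hval, ← Finset.mul_prod_erase R _ hj]
      have hcancel := div_mul_cancel₀ (α * (θ ^ j * x) + β) hne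
      simp only [eval_mul, eval_C, eval_add, eval_X, eval_prod, mul_assoc] at hcancel ⊢
      linear_combination -(exponentPoly θ f).coeff j *
        (∏ k ∈ R.erase j, (γ * (θ ^ k * x) + δ)) * hcancel
    rw [hprod, sum_coeff_exponentPoly_mul_eval, mul_zero]
  have hsub : (Finset.univ : Finset F) ⊆
      N.roots.toFinset ∪ R.biUnion fun j => S.image fun y => (θ ^ j)⁻¹ * y := by
    intro x _
    rw [Finset.mem_union, Multiset.mem_toFinset, mem_roots hNne, or_iff_not_imp_right]
    intro hx
    refine hroot x fun j hj hjS => hx ?_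
    simp only [Finset.mem_biUnion, Finset.mem_image]
    exact ⟨j, hj, _, hjS, inv_mul_cancel_left₀ (pow_ne_zero _ hθ0) _⟩
  calc Fintype.card F ≤ _ := Finset.card_le_card hsub
    _ ≤ _ := Finset.card_union_le _ _
    _ ≤ (w + 1) + (w + 1) * S.card := by
        refine add_le_add ((Multiset.toFinset_card_le _).trans ((card_roots' N).trans hNdeg)) ?_
        refine (Finset.card_biUnion_le_card_mul _ _ S.card fun _ _ =>
          Finset.card_image_le).trans_eq ?_
        rw [Finset.card_range]
    _ = _ := by ring

theorem card_lt_of_isCarlitzRep {f : F[X]} (hperm : Function.Bijective fun x : F => f.eval x)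
    (hred : f.natDegree < Fintype.card F) (hdeg : 2 ≤ f.natDegree)
    (hform : ¬ ∃ c₁ c₂ : F, c₂ ≠ 0 ∧ f = C c₁ + C c₂ * X ^ (Fintype.card F - 2)) {n : ℕ}
    (hn : IsCarlitzRep (Fintype.card F) f n) :
    Fintype.card F < (n + 1) * (f.support.card + 2) := by
  have hq : 3 ≤ Fintype.card F := by omega
  obtain ⟨a, h0, -, hdvd⟩ := hn
  obtain ⟨α, β, γ, δ, S, hdet, hSn, hS⟩ := exists_mobius_eq_carlitzChain hq h0 n
  have hfS : ∀ x ∉ S, γ * x + δ ≠ 0 ∧ f.eval x = (α * x + β) / (γ * x + δ) := by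
    intro x hx
    have := (X_pow_card_sub_X_dvd_iff _).1 hdvd x
    rw [eval_sub, sub_eq_zero] at this
    rw [this]
    exact hS x hx
  have of_two_terms : ∀ (c d : F) (e : ℕ), d ≠ 0 → e < Fintype.card F →
      Function.Surjective (fun x : F => x ^ e) → f ≠ C c + C d * X ^ e →
      (∀ x ∉ S, f.eval x = c + d * x ^ e) →
      Fintype.card F < (n + 1) * (f.support.card + 2) := by
    intro c d e hd he hsurj hne heval
    have hcard : (C c + C d * X ^ e : F[X]).support.card ≤ 2 := by
      have h := support_binomial_subset 0 e c d
      rw [pow_zero, mul_one] at h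
      exact (Finset.card_le_card h).trans Finset.card_le_two
    have hdegree : (C c + C d * X ^ e).natDegree < Fintype.card F := by
      refine (natDegree_add_le _ _).trans_lt (max_lt (by simp; omega) ?_)
      exact (natDegree_C_mul_X_pow_le d e).trans_lt he
    have hs : Function.Surjective fun x : F => (C c + C d * X ^ e).eval x := by
      intro y
      obtain ⟨x, hx⟩ := hsurj ((y - c) / d)
      refine ⟨x, ?_⟩
      simp only [eval_add, eval_mul, eval_pow, eval_C, eval_X] at hx ⊢
      rw [hx]
      field_simp
      ring
    have := card_sub_one_le_of_perm hperm.1 hs hred hdegree hne (S := S) (by simpa using heval)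
    have hle : (f.support.card + (C c + C d * X ^ e : F[X]).support.card) * S.card ≤
        (f.support.card + 2) * n := by gcongr
    have : (n + 1) * (f.support.card + 2) = (f.support.card + 2) * n + f.support.card + 2 := by
      ring
    have : f.support.card ≠ 0 := by
      rw [Ne, card_support_eq_zero]
      rintro rfl
      simp at hdeg
    omega
  rcases eq_or_ne γ 0 with rfl | hγ
  · have hαδ : α ≠ 0 ∧ δ ≠ 0 := by simpa using hdet
    refine of_two_terms (β / δ) (α / δ) 1 (div_ne_zero hαδ.1 hαδ.2) (by omega)
      (fun y => ⟨y, pow_one y⟩) ?_ fun x hx => ?_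
    · rintro rfl
      have : (C (β / δ) + C (α / δ) * X ^ 1).natDegree ≤ 1 := by
        rw [pow_one, add_comm]
        exact natDegree_linear_le
      omega
    · rw [(hfS x hx).2, zero_mul, zero_add, pow_one]
      ring
  rcases eq_or_ne δ 0 with rfl | hδ
  · have hβ : β ≠ 0 := by
      rintro rfl
      simp at hdet
    refine of_two_terms (α / γ) (β / γ) (Fintype.card F - 2) (div_ne_zero hβ hγ) (by omega)
      (fun y => ⟨y⁻¹, by simp [pow_card_sub_two hq]⟩)
      (fun h => hform ⟨_, _, div_ne_zero hβ hγ, h⟩) fun x hx => ?_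
    obtain ⟨hne, hval⟩ := hfS x hx
    have hx0 : x ≠ 0 := by
      rintro rfl
      simp at hne
    rw [hval, pow_card_sub_two hq]
    field_simp
    ring
  rcases Nat.lt_or_ge (f.support.card + 1) (Fintype.card F) with hw | hw
  · have := card_le_of_eval_eq_mobius hdet hγ hδ hw hfS
    calc Fintype.card F ≤ (f.support.card + 1) * (S.card + 1) := this
      _ ≤ (f.support.card + 1) * (n + 1) := by gcongr
      _ < (f.support.card + 2) * (n + 1) := by gcongr; omega
      _ = _ := mul_comm _ _
  · nlinarith

end SparsePolynomial

/-- **Theorem (Gómez-Pérez, Ostafe, Topuzoğlu).** Let `f` be a permutation polynomial of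
`F_q`, reduced mod `x^q - x`, with `deg f ≥ 2`, which is not of the form
`c₁ + c₂ x^{q-2}` with `c₂ ≠ 0`. Then `Crk(f) > q/(ω(f) + 2) - 1`. -/
theorem carlitzRank_gt_of_weight {F : Type*} [Field F] [Fintype F] (f : F[X])
    (hperm : Function.Bijective fun x : F => f.eval x)
    (hred : f.natDegree < Fintype.card F) (hdeg : 2 ≤ f.natDegree)
    (hform : ¬ ∃ c₁ c₂ : F, c₂ ≠ 0 ∧ f = C c₁ + C c₂ * X ^ (Fintype.card F - 2)) :
    (carlitzRank (Fintype.card F) f : ℝ) >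
      (Fintype.card F : ℝ) / (polyWeight (Fintype.card F) f + 2) - 1 := by
  have hrank : IsCarlitzRep (Fintype.card F) f (carlitzRank (Fintype.card F) f) :=
    Nat.sInf_mem (exists_isCarlitzRep (by omega) hperm)
  have hbound := card_lt_of_isCarlitzRep hperm hred hdeg hform hrank
  have hweight : polyWeight (Fintype.card F) f = f.support.card := by
    rw [polyWeight, (modByMonic_eq_self_iff monic_X_pow_card_sub_X).2]
    refine degree_lt_degree ?_
    rwa [FiniteField.X_pow_card_sub_X_natDegree_eq F Fintype.one_lt_card]
  rw [hweight, gt_iff_lt, sub_lt_iff_lt_add, div_lt_iff₀ (by positivity)]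
  exact_mod_cast hbound
end
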